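/- The linear operator field L(x,y,z) = [[2x−z,y,z−x],[y,z,0],[0,0,z]] on ℝ³ is a Nijenhuis operator; the coefficients of its characteristic polynomial are σ₁ = −2x−z, σ₂ = −y²+4xz−z², σ₃ = y²z−2xz²+z³, and these three polynomials are algebraically independent over ℝ. Consequently the algebra with relations η₁⋆η₁ = 2η₁, η₁⋆η₂ = η₂, η₁⋆η₃ = −η₁, η₂⋆η₂ = η₁, η₂⋆η₃ = η₂, η₃⋆η₁ = −η₁, η₃⋆η₃ = η₁+η₃ (other products zero) is a differentially non-degenerate LSA. -/

import Mathlib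

open Matrix

/-- Components `N^i_{jk}` of the Nijenhuis torsion of a matrix-valued operator
field `L` on `ℝⁿ` (with `L x i j = L^i_j(x)`). -/
noncomputable def nijTorsion {n : ℕ} (L : (Fin n → ℝ) → Matrix (Fin n) (Fin n) ℝ)
    (x : Fin n → ℝ) (i j k : Fin n) : ℝ :=
  ∑ s : Fin n,
    (L x s j * fderiv ℝ (fun y => L y i k) x (Pi.single s 1)
      - L x s k * fderiv ℝ (fun y => L y i j) x (Pi.single s 1)
      - L x i s * fderiv ℝ (fun y => L y s k) x (Pi.single j 1)
      + L x i s * fderiv ℝ (fun y => L y s j) x (Pi.single k 1))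

/-- `L` is a Nijenhuis operator: its Nijenhuis torsion vanishes identically. -/
def IsNijenhuis {n : ℕ} (L : (Fin n → ℝ) → Matrix (Fin n) (Fin n) ℝ) : Prop :=
  ∀ x i j k, nijTorsion L x i j k = 0

/-- Bilinear product on `ℝⁿ` with structure constants `a i j k`
(`ηᵢ ⋆ ηⱼ = ∑ₖ a i j k • ηₖ`). -/
def mulSC {n : ℕ} (a : Fin n → Fin n → Fin n → ℝ) (ξ η : Fin n → ℝ) : Fin n → ℝ :=
  fun k => ∑ i : Fin n, ∑ j : Fin n, a i j k * ξ i * η j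

/-- Left-symmetry: the associator is symmetric in its first two arguments. -/
def IsLSA {n : ℕ} (a : Fin n → Fin n → Fin n → ℝ) : Prop :=
  ∀ ξ η ζ : Fin n → ℝ,
    mulSC a (mulSC a ξ η) ζ - mulSC a ξ (mulSC a η ζ)
      = mulSC a (mulSC a η ξ) ζ - mulSC a η (mulSC a ξ ζ)

/-- The right-adjoint operator field of the algebra with structure constants `a`:
`(R x) k i = ∑ j, a i j k * x j`, i.e. `(R x).mulVec ξ = ξ ⋆ x`. -/
def rightAdj {n : ℕ} (a : Fin n → Fin n → Fin n → ℝ) (x : Fin n → ℝ) :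
    Matrix (Fin n) (Fin n) ℝ :=
  Matrix.of fun k i => ∑ j : Fin n, a i j k * x j

/-- `charCoeff L i` is the coefficient `σ_{i+1}` of `t^(n-1-i)` in the characteristic
polynomial `χ_{L(x)}(t) = tⁿ + σ₁(x) tⁿ⁻¹ + ⋯ + σₙ(x)` of `L(x)`. -/
noncomputable def charCoeff {n : ℕ} (L : (Fin n → ℝ) → Matrix (Fin n) (Fin n) ℝ)
    (i : Fin n) : (Fin n → ℝ) → ℝ :=
  fun x => (L x).charpoly.coeff (n - 1 - (i : ℕ))

/-- A (structure-constant) algebra is differentially non-degenerate if the coefficients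
of the characteristic polynomial of its right-adjoint operator are algebraically
independent over `ℝ` (as elements of the algebra of real-valued functions). -/
def DiffNonDeg {n : ℕ} (a : Fin n → Fin n → Fin n → ℝ) : Prop :=
  AlgebraicIndependent ℝ (charCoeff (rightAdj a))

/-- Isomorphism of the algebras on `ℝⁿ` with structure constants `a` and `b`. -/
def AlgIsoSC {n : ℕ} (a b : Fin n → Fin n → Fin n → ℝ) : Prop :=
  ∃ φ : (Fin n → ℝ) ≃ₗ[ℝ] (Fin n → ℝ),
    ∀ ξ η : Fin n → ℝ, φ (mulSC a ξ η) = mulSC b (φ ξ) (φ η)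

/-- Jacobi matrix of a family of functions `σ` on `ℝⁿ`: `J i j = ∂σᵢ/∂xⱼ`. -/
noncomputable def jacobiMat {n : ℕ} (σ : Fin n → (Fin n → ℝ) → ℝ) (x : Fin n → ℝ) :
    Matrix (Fin n) (Fin n) ℝ :=
  Matrix.of fun i j => fderiv ℝ (σ i) x (Pi.single j 1)

/-- Companion-type matrix with first column `(-s 0, …, -s (n-1))ᵀ`, ones on the
superdiagonal and zeros elsewhere. -/
def companionS {n : ℕ} (s : Fin n → ℝ) : Matrix (Fin n) (Fin n) ℝ :=
  Matrix.of fun i j => if (j : ℕ) = 0 then -s i else if (j : ℕ) = (i : ℕ) + 1 then 1 else 0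

/-- The operator field of the second indecomposable algebra. -/
def Lop (x : Fin 3 → ℝ) : Matrix (Fin 3) (Fin 3) ℝ :=
  Matrix.of ![![2 * x 0 - x 2, x 1, x 2 - x 0], ![x 1, x 2, 0], ![0, 0, x 2]]

/-- Structure constants of the second indecomposable algebra. -/
def sc : Fin 3 → Fin 3 → Fin 3 → ℝ :=
  ![![![2,0,0], ![0,1,0], ![-1,0,0]],
    ![![0,0,0], ![1,0,0], ![0,1,0]],
    ![![-1,0,0], ![0,0,0], ![1,0,1]]]

theorem aeval_fun_apply {ι X : Type*} (f : ι → X → ℝ) (p : MvPolynomial ι ℝ) (x : X) :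
    MvPolynomial.aeval f p x = MvPolynomial.eval (fun i => f i x) p := by
  have h := MvPolynomial.map_aeval (R := ℝ) f (Pi.evalRingHom (fun _ : X => ℝ) x) p
  simp only [Pi.evalRingHom_apply] at h
  rw [h, MvPolynomial.eval, MvPolynomial.coe_eval₂Hom, MvPolynomial.coe_eval₂Hom]
  rfl

/-- Functions whose joint image contains a product of infinite sets are algebraically
independent. -/
theorem algebraicIndependent_of_pi_subset_range {ι X : Type*} [Finite ι] (f : ι → X → ℝ)
    (S : ι → Set ℝ) (hS : ∀ i, (S i).Infinite)
    (h : Set.univ.pi S ⊆ Set.range fun x i => f i x) :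
    AlgebraicIndependent ℝ f := by
  rw [algebraicIndependent_iff]
  intro p hp
  refine MvPolynomial.funext_set S hS fun s hs => ?_
  obtain ⟨x, rfl⟩ := h hs
  rw [map_zero, ← aeval_fun_apply, hp, Pi.zero_apply]

theorem algebraicIndependent_sigma :
    AlgebraicIndependent ℝ
      ![(fun x : Fin 3 → ℝ => -2 * x 0 - x 2),
        (fun x : Fin 3 → ℝ => -(x 1 ^ 2) + 4 * x 0 * x 2 - x 2 ^ 2),
        (fun x : Fin 3 → ℝ => x 1 ^ 2 * x 2 - 2 * x 0 * x 2 ^ 2 + x 2 ^ 3)] := by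
  refine algebraicIndependent_of_pi_subset_range _
    ![Set.Iic 0, Set.Iic (-3), Set.Icc 0 2] ?_ ?_
  · intro i
    fin_cases i
    · exact Set.Iic_infinite _
    · exact Set.Iic_infinite _
    · exact Set.Icc_infinite (by norm_num)
  · intro s hs
    have ha : s 0 ≤ 0 := hs 0 trivial
    have hb : s 1 ≤ -3 := hs 1 trivial
    have hc : 0 ≤ s 2 ∧ s 2 ≤ 2 := hs 2 trivial
    obtain ⟨z, ⟨hz0, hz1⟩, hz⟩ : s 2 ∈ (fun z : ℝ => -z * s 1 - z ^ 2 * s 0 - z ^ 3) ''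
        Set.Icc 0 1 := by
      refine intermediate_value_Icc zero_le_one (by fun_prop) ⟨?_, ?_⟩
      · norm_num [hc.1]
      · norm_num
        linarith
    have hy : 0 ≤ -2 * s 0 * z - 3 * z ^ 2 - s 1 := by nlinarith
    obtain ⟨y, hy⟩ : ∃ y : ℝ, y ^ 2 = -2 * s 0 * z - 3 * z ^ 2 - s 1 := ⟨_, Real.sq_sqrt hy⟩
    refine ⟨![(-s 0 - z) / 2, y, z], ?_⟩
    ext i
    fin_cases i
    · simp
      ring
    · simp [hy]
      ring
    · simp [hy, ← hz]
      ring

theorem charpoly_Lop (x : Fin 3 → ℝ) :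
    (Lop x).charpoly = .X ^ 3 + .C (-2 * x 0 - x 2) * .X ^ 2
      + .C (-(x 1 ^ 2) + 4 * x 0 * x 2 - x 2 ^ 2) * .X
      + .C (x 1 ^ 2 * x 2 - 2 * x 0 * x 2 ^ 2 + x 2 ^ 3) := by
  simp [Matrix.charpoly, Matrix.det_fin_three, Matrix.charmatrix, Lop, map_ofNat Polynomial.C]
  ring

theorem charCoeff_Lop : charCoeff Lop =
    ![(fun x : Fin 3 → ℝ => -2 * x 0 - x 2),
      (fun x : Fin 3 → ℝ => -(x 1 ^ 2) + 4 * x 0 * x 2 - x 2 ^ 2),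
      (fun x : Fin 3 → ℝ => x 1 ^ 2 * x 2 - 2 * x 0 * x 2 ^ 2 + x 2 ^ 3)] := by
  ext i x
  rw [charCoeff, charpoly_Lop]
  fin_cases i <;> simp [Polynomial.coeff_X, Polynomial.coeff_C, -map_sub, -map_add, -map_mul,
    -map_neg, -map_pow, Polynomial.coeff_X_pow]

theorem rightAdj_sc : rightAdj sc = Lop := by
  ext x i j
  fin_cases i <;> fin_cases j <;> simp [rightAdj, sc, Lop, Fin.sum_univ_three] <;> ring

theorem isLSA_sc : IsLSA sc := by
  intro ξ η ζ
  ext k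
  fin_cases k <;> simp [mulSC, sc, Fin.sum_univ_three] <;> ring

/-- Partial derivatives of the right-adjoint operator are the structure constants. -/
theorem fderiv_rightAdj_single {n : ℕ} (a : Fin n → Fin n → Fin n → ℝ) (x : Fin n → ℝ)
    (i j s : Fin n) :
    fderiv ℝ (fun y => rightAdj a y i j) x (Pi.single s 1) = a j s i := by
  have h : HasFDerivAt (fun y => rightAdj a y i j)
      (∑ t, a j t i • ContinuousLinearMap.proj (R := ℝ) (φ := fun _ : Fin n => ℝ) t) x := by
    simp only [rightAdj, Matrix.of_apply]
    exact HasFDerivAt.fun_sum fun t _ => (hasFDerivAt_apply t x).const_mul _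
  rw [h.fderiv]
  simp [Pi.single_apply]

theorem isNijenhuis_Lop : IsNijenhuis Lop := by
  intro x i j k
  rw [← rightAdj_sc]
  simp only [nijTorsion, fderiv_rightAdj_single]
  rw [rightAdj_sc]
  fin_cases i <;> fin_cases j <;> fin_cases k <;>
    simp [sc, Lop, Fin.sum_univ_three] <;> ring

/-- The operator field is a Nijenhuis operator; the coefficients of its
characteristic polynomial are the stated polynomials, which are algebraically
independent over `ℝ`; it is the right-adjoint operator of the stated algebra,
which is consequently a differentially non-degenerate LSA. -/
theorem stmt13 :
    IsNijenhuis Lop ∧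
    (∀ x : Fin 3 → ℝ, charCoeff Lop 0 x = -2 * x 0 - x 2) ∧
    (∀ x : Fin 3 → ℝ, charCoeff Lop 1 x = -(x 1 ^ 2) + 4 * x 0 * x 2 - x 2 ^ 2) ∧
    (∀ x : Fin 3 → ℝ, charCoeff Lop 2 x = x 1 ^ 2 * x 2 - 2 * x 0 * x 2 ^ 2 + x 2 ^ 3) ∧
    AlgebraicIndependent ℝ
      ![(fun x : Fin 3 → ℝ => -2 * x 0 - x 2),
        (fun x : Fin 3 → ℝ => -(x 1 ^ 2) + 4 * x 0 * x 2 - x 2 ^ 2),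
        (fun x : Fin 3 → ℝ => x 1 ^ 2 * x 2 - 2 * x 0 * x 2 ^ 2 + x 2 ^ 3)] ∧
    rightAdj sc = Lop ∧ IsLSA sc ∧ DiffNonDeg sc := by
  refine ⟨isNijenhuis_Lop, fun x => ?_, fun x => ?_, fun x => ?_, algebraicIndependent_sigma,
    rightAdj_sc, isLSA_sc, ?_⟩
  · rw [charCoeff_Lop]; rfl
  · rw [charCoeff_Lop]; rfl
  · rw [charCoeff_Lop]; rfl
  · rw [DiffNonDeg, rightAdj_sc, charCoeff_Lop]
    exact algebraicIndependent_sigma
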